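/- For every formula H of nPC and every permutation π ∈ S_n, the formulas H^π and q(H, e_{π(1)}, …, e_{π(n)}) are equivalent: H^π ∼ q(H, e_{π(1)}, …, e_{π(n)}). -/

import Mathlib

/-- Formulas of the n-dimensional propositional calculus nPC:
decorated variables `X^π`, constants `e_k`, and compounds `q(F,G_1,…,G_n)`.
Dimensions are elements of `Fin n`; propositional variables are natural numbers. -/
inductive Fm (n : ℕ) : Type where
  | var (X : ℕ) (π : Equiv.Perm (Fin n)) : Fm n
  | const (k : Fin n) : Fm n
  | q (F : Fm n) (G : Fin n → Fm n) : Fm n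

/-- The action `F^ρ` of a permutation `ρ` on a formula. -/
def Fm.act {n : ℕ} (ρ : Equiv.Perm (Fin n)) : Fm n → Fm n
  | .var X π => .var X (ρ * π)
  | .const k => .const (ρ k)
  | .q F G => .q F (fun j => (G j).act ρ)

/-- The action of a permutation on a multiset of formulas (context). -/
def actM {n : ℕ} (ρ : Equiv.Perm (Fin n)) (Γ : Multiset (Fm n)) : Multiset (Fm n) :=
  Γ.map (Fm.act ρ)

/-- The sequent calculus of nPC: `Proves Γ i Δ` means the sequent `Γ ⊢_i Δ` is provable. -/
inductive Proves {n : ℕ} : Multiset (Fm n) → Fin n → Multiset (Fm n) → Prop where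
  | const (i : Fin n) : Proves 0 i {Fm.const i}
  | id (X : ℕ) (π ρ : Equiv.Perm (Fin n)) (i : Fin n) (h : π⁻¹ i = ρ⁻¹ i) :
      Proves {Fm.var X π} i {Fm.var X ρ}
  | sym (Γ Δ : Multiset (Fm n)) (i j : Fin n)
      (h : Proves (actM (Equiv.swap i j) Γ) i (actM (Equiv.swap i j) Δ)) :
      Proves Γ j Δ
  | neg1 (Γ Δ : Multiset (Fm n)) (F : Fm n) (i j k : Fin n) (hik : i ≠ k)
      (h : Proves (actM (Equiv.swap i j) Γ) i (F ::ₘ actM (Equiv.swap i j) Δ)) :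
      Proves (F.act (Equiv.swap j k) ::ₘ Γ) j Δ
  | neg2 (Γ Δ : Multiset (Fm n)) (F : Fm n) (i j k : Fin n) (hjk : j ≠ k)
      (h : Proves (actM (Equiv.swap i j) Γ) i (F ::ₘ actM (Equiv.swap i j) Δ)) :
      Proves (F.act (Equiv.swap i k) ::ₘ Γ) j Δ
  | neg3 (Γ Δ : Multiset (Fm n)) (F : Fm n) (j : Fin n)
      (h : ∀ i : Fin n, i ≠ j →
        Proves (F ::ₘ actM (Equiv.swap i j) Γ) i (actM (Equiv.swap i j) Δ)) :
      Proves Γ j (F ::ₘ Δ)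
  | qL (Γ Δ : Multiset (Fm n)) (F : Fm n) (G : Fin n → Fm n) (i : Fin n)
      (h : ∀ j : Fin n,
        Proves ((G j).act (Equiv.swap j i) ::ₘ F ::ₘ actM (Equiv.swap j i) Γ) j
          (actM (Equiv.swap j i) Δ)) :
      Proves (Fm.q F G ::ₘ Γ) i Δ
  | qR (Γ Δ : Multiset (Fm n)) (F : Fm n) (G : Fin n → Fm n) (i : Fin n)
      (h : ∀ j : Fin n,
        Proves (F ::ₘ actM (Equiv.swap j i) Γ) j
          ((G j).act (Equiv.swap j i) ::ₘ actM (Equiv.swap j i) Δ)) :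
      Proves Γ i (Fm.q F G ::ₘ Δ)
  | cut (Γ Δ : Multiset (Fm n)) (F : Fm n) (i : Fin n)
      (h1 : Proves (F ::ₘ Γ) i Δ) (h2 : Proves Γ i (F ::ₘ Δ)) : Proves Γ i Δ
  | weakL (Γ Δ : Multiset (Fm n)) (F : Fm n) (i : Fin n)
      (h : Proves Γ i Δ) : Proves (F ::ₘ Γ) i Δ
  | weakR (Γ Δ : Multiset (Fm n)) (F : Fm n) (i : Fin n)
      (h : Proves Γ i Δ) : Proves Γ i (F ::ₘ Δ)
  | conL (Γ Δ : Multiset (Fm n)) (F : Fm n) (i : Fin n)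
      (h : Proves (F ::ₘ F ::ₘ Γ) i Δ) : Proves (F ::ₘ Γ) i Δ
  | conR (Γ Δ : Multiset (Fm n)) (F : Fm n) (i : Fin n)
      (h : Proves Γ i (F ::ₘ F ::ₘ Δ)) : Proves Γ i (F ::ₘ Δ)

/-- The semantics `⟦F⟧v` of a formula in an environment `v`. -/
def Fm.sem {n : ℕ} (v : ℕ → Fin n) : Fm n → Fin n
  | .var X π => π (v X)
  | .const k => k
  | .q F G => (G (F.sem v)).sem v

/-- `Γ ⊨_i Δ`: every environment making all of `Γ` equal `i` makes some formula of `Δ` equal `i`. -/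
def Models {n : ℕ} (Γ : Multiset (Fm n)) (i : Fin n) (Δ : Multiset (Fm n)) : Prop :=
  ∀ v : ℕ → Fin n, (∀ G ∈ Γ, Fm.sem v G = i) → ∃ F ∈ Δ, Fm.sem v F = i

/-- Logical equivalence `F ∼ G`: both `F ⊢_i G` and `G ⊢_i F` are provable for every `i`. -/
def Eqv {n : ℕ} (F G : Fm n) : Prop :=
  ∀ i : Fin n, Proves {F} i {G} ∧ Proves {G} i {F}

/-- Provability from a (possibly infinite) set of hypotheses:
some finite sub-multiset of `Γ` proves `Δ` at `i`. -/
def ProvesSet {n : ℕ} (Γ : Set (Fm n)) (i : Fin n) (Δ : Multiset (Fm n)) : Prop :=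
  ∃ Γ' : Multiset (Fm n), (∀ G ∈ Γ', G ∈ Γ) ∧ Proves Γ' i Δ

/-- `Γ ⊨_i F` for a set `Γ` of hypotheses. -/
def ModelsSet {n : ℕ} (Γ : Set (Fm n)) (i : Fin n) (F : Fm n) : Prop :=
  ∀ v : ℕ → Fin n, (∀ G ∈ Γ, Fm.sem v G = i) → Fm.sem v F = i

open Equiv (swap)

section

variable {n : ℕ}

theorem Fm.act_one (F : Fm n) : F.act 1 = F := by
  induction F with
  | var X π => simp [Fm.act]
  | const k => simp [Fm.act]
  | q F G _ ihG => simp [Fm.act, ihG]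

theorem Fm.act_act (ρ σ : Equiv.Perm (Fin n)) (F : Fm n) :
    (F.act σ).act ρ = F.act (ρ * σ) := by
  induction F with
  | var X π => simp [Fm.act, mul_assoc]
  | const k => simp [Fm.act]
  | q F G _ ihG => simp [Fm.act, ihG]

@[simp]
theorem actM_zero (ρ : Equiv.Perm (Fin n)) : actM ρ 0 = 0 := rfl

@[simp]
theorem actM_singleton (ρ : Equiv.Perm (Fin n)) (F : Fm n) : actM ρ {F} = {F.act ρ} := rfl

@[simp]
theorem actM_cons (ρ : Equiv.Perm (Fin n)) (F : Fm n) (Γ : Multiset (Fm n)) :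
    actM ρ (F ::ₘ Γ) = F.act ρ ::ₘ actM ρ Γ :=
  Multiset.map_cons _ _ _

theorem actM_one (Γ : Multiset (Fm n)) : actM 1 Γ = Γ := by
  simp [actM, Fm.act_one]

namespace Proves

theorem weaken_left {Γ Γ' Δ : Multiset (Fm n)} {i : Fin n} (h : Proves Γ i Δ) (hΓ : Γ ≤ Γ') :
    Proves Γ' i Δ := by
  obtain ⟨Θ, rfl⟩ := Multiset.le_iff_exists_add.1 hΓ
  clear hΓ
  induction Θ using Multiset.induction with
  | empty => simpa using h
  | cons F Θ ih => simpa using weakL _ _ F _ ih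

theorem weaken_right {Γ Δ Δ' : Multiset (Fm n)} {i : Fin n} (h : Proves Γ i Δ) (hΔ : Δ ≤ Δ') :
    Proves Γ i Δ' := by
  obtain ⟨Θ, rfl⟩ := Multiset.le_iff_exists_add.1 hΔ
  clear hΔ
  induction Θ using Multiset.induction with
  | empty => simpa using h
  | cons F Θ ih => simpa using weakR _ _ F _ ih

/-- Weakening on both sides at once. -/
theorem weaken {Γ Γ' Δ Δ' : Multiset (Fm n)} {i : Fin n} (h : Proves Γ i Δ)
    (hΓ : Γ ≤ Γ') (hΔ : Δ ≤ Δ') : Proves Γ' i Δ' :=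
  (h.weaken_left hΓ).weaken_right hΔ

/-- The negation rule within a single dimension. -/
theorem neg_same {Γ Δ : Multiset (Fm n)} {F : Fm n} {i k : Fin n} (hik : i ≠ k)
    (h : Proves Γ i (F ::ₘ Δ)) : Proves (F.act (swap i k) ::ₘ Γ) i Δ :=
  neg1 Γ Δ F i i k hik (by simpa [Equiv.Perm.one_def.symm, actM_one] using h)

theorem const_ne {i k : Fin n} (hik : i ≠ k) : Proves {Fm.const k} i 0 := by
  simpa [Fm.act] using neg_same (Δ := 0) hik (const i)

/-- If `F` entails each of its images under permutations fixing `i`, then `F` and its image under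
a permutation moving `i` are contradictory at `i`. -/
theorem contradiction_of_forall_act {F : Fm n} {i : Fin n}
    (hF : ∀ τ : Equiv.Perm (Fin n), τ i = i → Proves {F} i {F.act τ})
    {σ : Equiv.Perm (Fin n)} (hσ : σ i ≠ i) : Proves (F ::ₘ {F.act σ}) i 0 := by
  have h := neg_same (Δ := 0) hσ.symm (hF (swap i (σ i) * σ) (by simp))
  rw [Fm.act_act, Equiv.swap_mul_self_mul] at h
  exact Multiset.cons_swap _ _ 0 ▸ h

theorem act_of_fixed (F : Fm n) (i : Fin n) (τ : Equiv.Perm (Fin n)) (hτ : τ i = i) :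
    Proves {F} i {F.act τ} := by
  induction F generalizing i τ with
  | var X π =>
    refine id X π (τ * π) i ?_
    rw [mul_inv_rev, Equiv.Perm.mul_apply, Equiv.Perm.inv_eq_iff_eq.2 hτ.symm]
  | const k =>
    by_cases hik : i = k
    · subst hik
      simpa [Fm.act, hτ] using weakL _ _ (Fm.const i) _ (const i)
    · exact (const_ne hik).weaken_right (Multiset.zero_le _)
  | q F G ihF ihG =>
    refine qL 0 _ F G i fun j => ?_
    refine qR _ 0 F _ j fun k => ?_
    by_cases hkj : k = j
    · subst hkj
      have h : Proves {(G k).act (swap k i)} k {((G k).act τ).act (swap k i)} := by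
        refine sym _ _ i k ?_
        simpa [Fm.act_act, Equiv.swap_comm k i, Fm.act_one, ← mul_assoc] using ihG k i τ hτ
      refine h.weaken ?_ ?_ <;> simp [Equiv.Perm.one_def.symm, Fm.act_one]
    · have h := contradiction_of_forall_act (ihF k) (σ := swap k j) (by simpa using Ne.symm hkj)
      refine h.weaken ?_ (Multiset.zero_le _)
      exact (Multiset.cons_le_cons_iff F).2 (by simp)

/-- A formula and its image under a permutation moving `i` are contradictory at `i`. -/
theorem contradiction_act (F : Fm n) {i : Fin n} {σ : Equiv.Perm (Fin n)} (hσ : σ i ≠ i) :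
    Proves (F ::ₘ {F.act σ}) i 0 :=
  contradiction_of_forall_act (act_of_fixed F i) hσ

end Proves

end

/-- For every formula `H` and permutation `π`:
`H^π ∼ q(H, e_{π(1)}, …, e_{π(n)})`. -/
theorem act_eqv_q_consts (n : ℕ) (hn : 2 ≤ n) (H : Fm n) (π : Equiv.Perm (Fin n)) :
    Eqv (Fm.act π H) (Fm.q H (fun j => Fm.const (π j))) := by
  refine fun i => ⟨Proves.qR _ 0 H _ i fun j => ?_, Proves.qL 0 _ H _ i fun j => ?_⟩
  · by_cases hj : π j = i
    · have h := Proves.const j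
      refine h.weaken (Multiset.zero_le _) ?_
      simp [Fm.act, hj]
    · have h := Proves.contradiction_act H (i := j) (σ := swap j i * π)
        (by simpa [Equiv.swap_apply_eq_iff] using hj)
      refine h.weaken ?_ (Multiset.zero_le _)
      simp [Fm.act_act]
  · by_cases hj : π j = i
    · have h := Proves.act_of_fixed H j (swap j i * π) (by simp [hj])
      refine h.weaken ?_ ?_ <;> simp [Fm.act_act]
    · have h := Proves.const_ne (i := j) (k := swap j i (π j))
        (Ne.symm (by simpa [Equiv.swap_apply_eq_iff] using hj))
      refine h.weaken ?_ (Multiset.zero_le _)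
      simp [Fm.act]
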